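/- arXiv:2508.04185 — 2 statements merged into one kernel-verified Lean document; each statement's English description precedes it below -/
import Mathlib

section
/- Let S2, Ps, N0, γth1, γth2 be positive reals. Then 1 − γth2·N0/(S2·Ps) ≥ (γth1·S2·Ps + γth1·N0)/(S2·Ps + γth1·S2·Ps) if and only if S2 ≥ (γth1·γth2 + γth1 + γth2)·N0/Ps. -/
/-- For positive S2, Ps, N0, γth1, γth2:
1 − γth2·N0/(S2·Ps) ≥ (γth1·S2·Ps + γth1·N0)/(S2·Ps + γth1·S2·Ps)
↔ S2 ≥ (γth1·γth2 + γth1 + γth2)·N0/Ps. -/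
theorem stmt_5 (S2 Ps N0 γth1 γth2 : ℝ) (hS2 : 0 < S2) (hPs : 0 < Ps) (hN0 : 0 < N0)
    (hγ1 : 0 < γth1) (hγ2 : 0 < γth2) :
    1 - γth2 * N0 / (S2 * Ps) ≥ (γth1 * S2 * Ps + γth1 * N0) / (S2 * Ps + γth1 * S2 * Ps) ↔
      S2 ≥ (γth1 * γth2 + γth1 + γth2) * N0 / Ps := by
  have hD : 0 < S2 * Ps + γth1 * S2 * Ps := by positivity
  have key : 1 - γth2 * N0 / (S2 * Ps) -
      (γth1 * S2 * Ps + γth1 * N0) / (S2 * Ps + γth1 * S2 * Ps) =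
      (S2 * Ps - (γth1 * γth2 + γth1 + γth2) * N0) / (S2 * Ps + γth1 * S2 * Ps) := by
    rw [eq_div_iff hD.ne', sub_mul, div_mul_cancel₀ _ hD.ne']
    field_simp
    ring
  rw [ge_iff_le, ge_iff_le, ← sub_nonneg, key, le_div_iff₀ hD, zero_mul, sub_nonneg,
    div_le_iff₀ hPs]
end

section
/- Let S1, S2, Ps, N0, γth1, γth2 be positive reals with S2 > (γth1·γth2 + γth1 + γth2)·N0/Ps. Set L = (γth1·S2·Ps + γth1·N0)/(S2·Ps + γth1·S2·Ps) and U = 1 − γth2·N0/(S2·Ps). Then 0 < L < U < 1, and the supremum over α1 ∈ (L, U) of γ1(α1) = S1·α1·Ps/(S1·(1−α1)·Ps + N0) equals γ1(U) = S1·(S2·Ps − γth2·N0) / (N0·(S1·γth2 + S2)). -/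
/-- The signal-to-interference ratio is monotone in the power fraction `x ≤ 1`. -/
theorem monotoneOn_sinr {S P N : ℝ} (hS : 0 < S) (hP : 0 < P) (hN : 0 < N) :
    MonotoneOn (fun x : ℝ => S * x * P / (S * (1 - x) * P + N)) (Set.Iic 1) := by
  have den_pos : ∀ x ≤ (1 : ℝ), 0 < S * (1 - x) * P + N := fun x hx => by
    have := sub_nonneg.2 hx
    positivity
  intro x hx y hy hxy
  have key : 0 ≤ S * P * (S * P + N) * (y - x) :=
    mul_nonneg (by positivity) (sub_nonneg.2 hxy)
  change S * x * P / (S * (1 - x) * P + N) ≤ S * y * P / (S * (1 - y) * P + N)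
  rw [div_le_div_iff₀ (den_pos x hx) (den_pos y hy)]
  linarith

/-- Over an open interval `(a, b)` with `b ≤ 1`, the supremum of the signal-to-interference ratio
is its value at `b`. -/
theorem isLUB_sinr_image_Ioo {S P N a b : ℝ} (hS : 0 < S) (hP : 0 < P) (hN : 0 < N)
    (hab : a < b) (hb : b ≤ 1) :
    IsLUB ((fun x : ℝ => S * x * P / (S * (1 - x) * P + N)) '' Set.Ioo a b)
      (S * b * P / (S * (1 - b) * P + N)) := by
  refine IsLUB.isLUB_of_tendsto
    ((monotoneOn_sinr hS hP hN).mono fun x hx => hx.2.le.trans hb)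
    (isLUB_Ioo hab) (Set.nonempty_Ioo.2 hab) ?_
  have hden : S * (1 - b) * P + N ≠ 0 := by
    have := sub_nonneg.2 hb
    positivity
  have hcont : ContinuousAt (fun x : ℝ => S * x * P / (S * (1 - x) * P + N)) b :=
    ContinuousAt.div (by fun_prop) (by fun_prop) hden
  exact hcont.tendsto.mono_left nhdsWithin_le_nhds

/-- Proposition 1: with S2·Ps strictly above the feasibility threshold, the feasible
interval (L, U) for α1 satisfies 0 < L < U < 1, and the supremum of
γ1(α1) = S1·α1·Ps/(S1·(1−α1)·Ps + N0) over α1 ∈ (L, U) equals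
γ1(U) = S1·(S2·Ps − γth2·N0) / (N0·(S1·γth2 + S2)). -/
theorem stmt_6 (S1 S2 Ps N0 γth1 γth2 : ℝ) (hS1 : 0 < S1) (hS2 : 0 < S2)
    (hPs : 0 < Ps) (hN0 : 0 < N0) (hγ1 : 0 < γth1) (hγ2 : 0 < γth2)
    (hfeas : S2 > (γth1 * γth2 + γth1 + γth2) * N0 / Ps)
    (L U : ℝ)
    (hL : L = (γth1 * S2 * Ps + γth1 * N0) / (S2 * Ps + γth1 * S2 * Ps))
    (hU : U = 1 - γth2 * N0 / (S2 * Ps)) :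
    (0 < L ∧ L < U ∧ U < 1) ∧
    IsLUB ((fun α1 : ℝ => S1 * α1 * Ps / (S1 * (1 - α1) * Ps + N0)) '' Set.Ioo L U)
      (S1 * U * Ps / (S1 * (1 - U) * Ps + N0)) ∧
    S1 * U * Ps / (S1 * (1 - U) * Ps + N0) =
      S1 * (S2 * Ps - γth2 * N0) / (N0 * (S1 * γth2 + S2)) := by
  have hlt : (γth1 * γth2 + γth1 + γth2) * N0 < S2 * Ps := (div_lt_iff₀ hPs).1 hfeas
  have hU1 : U < 1 := by
    rw [hU]
    exact sub_lt_self 1 (by positivity)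
  have hLU : L < U := by
    have hU' : U = (S2 * Ps - γth2 * N0) * (1 + γth1) / (S2 * Ps + γth1 * S2 * Ps) := by
      rw [hU]
      field_simp
    rw [hL, hU']
    gcongr
    linarith
  refine ⟨⟨by rw [hL]; positivity, hLU, hU1⟩, isLUB_sinr_image_Ioo hS1 hPs hN0 hLU hU1.le, ?_⟩
  have hnum : S1 * U * Ps = S1 * (S2 * Ps - γth2 * N0) / S2 := by
    rw [hU]
    field_simp
  have hden : S1 * (1 - U) * Ps + N0 = N0 * (S1 * γth2 + S2) / S2 := by
    rw [hU, sub_sub_cancel]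
    field_simp
  rw [hnum, hden, div_div_div_cancel_right₀ hS2.ne']
end
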